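/- Let K be an algebraically closed field of characteristic zero, R = K[y,z], d a nonnegative integer, r ∈ {0, …, d}, and let F = c₁·ℓ₁^d + ⋯ + c_r·ℓ_r^d with ℓ₁, …, ℓ_r pairwise linearly independent linear forms in y, z and c₁, …, c_r ∈ K. If F is a scalar multiple of z^d (equivalently, F is divisible by z^r), then at most one of the coefficients c₁, …, c_r is nonzero. -/

import Mathlib

open MvPolynomial

/-- A binary linear form is determined by its two coefficients. -/
theorem MvPolynomial.IsHomogeneous.exists_eq_binary_linear {K : Type*} [Field K]
    {f : MvPolynomial (Fin 2) K} (hf : f.IsHomogeneous 1) :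
    ∃ p q : K, f = C p * X 0 + C q * X 1 := by
  have h : f ∈ homogeneousSubmodule (Fin 2) K 1 := hf
  rw [homogeneousSubmodule_one_eq_span_X] at h
  have hr : Set.range (X : Fin 2 → MvPolynomial (Fin 2) K) = {X 0, X 1} := by
    ext x; simp [eq_comm]
  rw [hr, Submodule.mem_span_pair] at h
  obtain ⟨p, q, rfl⟩ := h
  exact ⟨p, q, by simp [smul_eq_C_mul]⟩

/-- Linearly independent binary linear forms have nonzero determinant. -/
theorem MvPolynomial.det_ne_zero_of_linearIndependent {K : Type*} [Field K] {p q p' q' : K}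
    (h : LinearIndependent K ![(C p * X 0 + C q * X 1 : MvPolynomial (Fin 2) K),
      C p' * X 0 + C q' * X 1]) : q' * p - p' * q ≠ 0 := by
  intro hdet
  rw [LinearIndependent.pair_iff] at h
  have hC : (C q' * C p - C p' * C q : MvPolynomial (Fin 2) K) = 0 := by
    rw [← C_mul, ← C_mul, ← C_sub, hdet, C_0]
  obtain ⟨hq', hq⟩ := h q' (-q) (by
    simp only [smul_eq_C_mul, C_neg]; linear_combination X 0 * hC)
  obtain ⟨hp', hp⟩ := h p' (-p) (by
    simp only [smul_eq_C_mul, C_neg]; linear_combination (-X 1) * hC)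
  rw [neg_eq_zero] at hq hp
  simpa [hp, hp', hq, hq'] using h 1 1

/-- The coefficients of the `d`-th power of a univariate polynomial of degree at most one. -/
theorem Polynomial.coeff_C_mul_X_add_C_pow {K : Type*} [CommSemiring K] (p q : K) {d n : ℕ}
    (hn : n ≤ d) :
    ((Polynomial.C p * Polynomial.X + Polynomial.C q) ^ d).coeff n =
      p ^ n * q ^ (d - n) * d.choose n := by
  have hterm : ∀ m, (Polynomial.C p * Polynomial.X) ^ m * Polynomial.C q ^ (d - m) *
      (d.choose m : Polynomial K) =
      Polynomial.C (p ^ m * q ^ (d - m) * d.choose m) * Polynomial.X ^ m := fun m => by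
    simp only [Polynomial.C_mul, Polynomial.C_pow, Polynomial.C_eq_natCast]
    ring
  simp only [add_pow, hterm, Polynomial.finsetSum_coeff, Polynomial.coeff_C_mul_X_pow]
  rw [Finset.sum_ite_eq, if_pos (Finset.mem_range.2 (Nat.lt_succ_of_le hn))]

/-- If `∑ cₖ (pₖ y + qₖ z)^d` is a multiple of `z^d`, its mixed moments involving `y` vanish. -/
theorem MvPolynomial.sum_moment_eq_zero {K ι : Type*} [Field K] [CharZero K] [Fintype ι]
    {d : ℕ} {c p q : ι → K} {a : K}
    (h : ∑ k, c k • (C (p k) * X 0 + C (q k) * X 1 : MvPolynomial (Fin 2) K) ^ d =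
      C a * X 1 ^ d) {m n : ℕ} (hmn : m + 1 + n = d) :
    ∑ k, c k * (p k ^ (m + 1) * q k ^ n) = 0 := by
  have h' := congrArg (fun f => (aeval ![(Polynomial.X : Polynomial K), 1] f).coeff (m + 1)) h
  simp only [map_sum, map_smul, map_pow, map_add, map_mul, aeval_X, algHom_C,
    Polynomial.algebraMap_eq, Matrix.cons_val_zero, Matrix.cons_val_one, mul_one, one_pow,
    Polynomial.finsetSum_coeff, Polynomial.coeff_smul, smul_eq_mul,
    Polynomial.coeff_C_succ] at h'
  have hn : d - (m + 1) = n := by omega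
  simp only [Polynomial.coeff_C_mul_X_add_C_pow _ _ (show m + 1 ≤ d by omega), hn,
    ← mul_assoc, ← Finset.sum_mul] at h'
  have hch : (d.choose (m + 1) : K) ≠ 0 :=
    Nat.cast_ne_zero.2 (Nat.choose_pos (by omega)).ne'
  simpa only [mul_assoc] using (mul_eq_zero.1 h').resolve_right hch

/-- The moments of a power sum equal to a multiple of `z^d` annihilate every form `y * H`. -/
theorem MvPolynomial.sum_mul_eval_eq_zero_of_isHomogeneous {K ι : Type*} [Field K] [CharZero K] [Fintype ι]
    {d : ℕ} {c p q : ι → K} {a : K}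
    (h : ∑ k, c k • (C (p k) * X 0 + C (q k) * X 1 : MvPolynomial (Fin 2) K) ^ (d + 1) =
      C a * X 1 ^ (d + 1)) {H : MvPolynomial (Fin 2) K} (hH : H.IsHomogeneous d) :
    ∑ k, c k * (p k * eval ![p k, q k] H) = 0 := by
  simp only [eval_eq', Fin.prod_univ_two, Matrix.cons_val_zero, Matrix.cons_val_one,
    Finset.mul_sum]
  rw [Finset.sum_comm]
  refine Finset.sum_eq_zero fun s hs => ?_
  have hdeg : s 0 + s 1 = d := by
    have := hH (mem_support_iff.1 hs)
    rwa [Finsupp.weight_apply, Finsupp.sum_fintype _ _ (by simp), Fin.sum_univ_two,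
      Pi.one_apply, Pi.one_apply, smul_eq_mul, smul_eq_mul, mul_one, mul_one] at this
  calc ∑ k, c k * (p k * (coeff s H * (p k ^ s 0 * q k ^ s 1)))
      = coeff s H * ∑ k, c k * (p k ^ (s 0 + 1) * q k ^ s 1) := by
        rw [Finset.mul_sum]
        exact Finset.sum_congr rfl fun k _ => by ring
    _ = 0 := by rw [sum_moment_eq_zero h (by omega), mul_zero]

/-- In a power sum equal to a multiple of `z^d` with at most `d` pairwise independent terms,
only a term whose linear form is proportional to `z` can have a nonzero coefficient. -/
theorem MvPolynomial.coeff_eq_zero_of_sum_pow_eq {K ι : Type*} [Field K] [CharZero K]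
    [Fintype ι] {d : ℕ} (hd : Fintype.card ι ≤ d) {c p q : ι → K} {a : K}
    (hdet : ∀ i k, i ≠ k → q k * p i - p k * q i ≠ 0)
    (h : ∑ k, c k • (C (p k) * X 0 + C (q k) * X 1 : MvPolynomial (Fin 2) K) ^ d =
      C a * X 1 ^ d) {i : ι} (hi : p i ≠ 0) : c i = 0 := by
  classical
  have hpos : 0 < Fintype.card ι := Fintype.card_pos_iff.2 ⟨i⟩
  obtain ⟨e, rfl⟩ := Nat.exists_eq_succ_of_ne_zero (show d ≠ 0 by omega)
  set r := Fintype.card ι with hr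
  let P : MvPolynomial (Fin 2) K :=
    ∏ k ∈ Finset.univ.erase i, (C (q k) * X 0 - C (p k) * X 1)
  have hP : P.IsHomogeneous (r - 1) := by
    have := IsHomogeneous.prod (Finset.univ.erase i)
      (fun k => (C (q k) * X 0 - C (p k) * X 1 : MvPolynomial (Fin 2) K)) (fun _ => 1)
      (fun k _ => (isHomogeneous_C_mul_X _ _).sub (isHomogeneous_C_mul_X _ _))
    simpa [Finset.card_erase_of_mem, ← hr] using this
  have hH : (X 0 ^ (e + 1 - r) * P).IsHomogeneous e := by
    have := (isHomogeneous_X_pow (R := K) (0 : Fin 2) (e + 1 - r)).mul hP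
    rwa [show e + 1 - r + (r - 1) = e by omega] at this
  have hsum := sum_mul_eval_eq_zero_of_isHomogeneous h hH
  simp only [P, map_mul, map_pow, map_prod, map_sub, eval_X, eval_C, Matrix.cons_val_zero,
    Matrix.cons_val_one] at hsum
  rw [Finset.sum_eq_single i] at hsum
  · refine (mul_eq_zero.1 hsum).resolve_right
      (mul_ne_zero hi (mul_ne_zero (pow_ne_zero _ hi) ?_))
    exact Finset.prod_ne_zero_iff.2 fun k hk => hdet i k (Finset.ne_of_mem_erase hk).symm
  · intro k _ hk
    rw [Finset.prod_eq_zero (Finset.mem_erase.2 ⟨hk, Finset.mem_univ k⟩) (by ring)]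
    ring
  · exact fun hni => absurd (Finset.mem_univ i) hni

/-- If `F = c₁·ℓ₁^d + ⋯ + c_r·ℓ_r^d` with pairwise linearly independent linear
forms `ℓᵢ ∈ K[y,z]` (with `y = X 0`, `z = X 1`), `0 ≤ r ≤ d`, and `F` is a scalar
multiple of `z^d`, then at most one coefficient `cᵢ` is nonzero. -/
theorem at_most_one_nonzero_coeff (K : Type*) [Field K] [IsAlgClosed K] [CharZero K]
    (d r : ℕ) (hr : r ≤ d)
    (c : Fin r → K) (ℓ : Fin r → MvPolynomial (Fin 2) K)
    (hhom : ∀ i, (ℓ i).IsHomogeneous 1)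
    (hind : ∀ i j, i ≠ j → LinearIndependent K ![ℓ i, ℓ j])
    (F : MvPolynomial (Fin 2) K) (hF : F = ∑ i, c i • ℓ i ^ d)
    (hz : ∃ a : K, F = C a * X 1 ^ d) :
    ∀ i j, c i ≠ 0 → c j ≠ 0 → i = j := by
  obtain ⟨a, ha⟩ := hz
  choose p q hpq using fun i => (hhom i).exists_eq_binary_linear
  have hdet : ∀ i k, i ≠ k → q k * p i - p k * q i ≠ 0 := fun i k hik => by
    have := hind i k hik
    rw [hpq i, hpq k] at this
    exact det_ne_zero_of_linearIndependent this
  have hsum : ∑ k, c k • (C (p k) * X 0 + C (q k) * X 1 : MvPolynomial (Fin 2) K) ^ d =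
      C a * X 1 ^ d := by
    rw [← ha, hF]
    exact Finset.sum_congr rfl fun k _ => by rw [← hpq k]
  have hp : ∀ i, c i ≠ 0 → p i = 0 := fun i hci => by
    by_contra hi
    exact hci (coeff_eq_zero_of_sum_pow_eq (by simpa using hr) hdet hsum hi)
  intro i j hi hj
  by_contra hij
  exact hdet i j hij (by rw [hp i hi, hp j hj]; ring)
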